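/- (Sufficiency of global testing for the weak-type bound, p < q.) Let 1 < p < q < ∞, let τ = (τ_Q)_{Q∈𝒬} be nonnegative constants, and let σ, ω be weights on ℝ^d. Suppose the global testing constant 𝔊 = ⟦σ,ω⟧^Glo_{τ,p,q} is finite. Then for every nonnegative f ∈ L^p(σ) and every λ > 0, λ^q · ω({x : T_τ(fσ)(x) > λ}) ≤ C(p,q,d) · 𝔊^q · ‖f‖_{L^p(σ)}^q. -/

import Mathlib

open MeasureTheory ENNReal

noncomputable section

/-- Index set for dyadic cubes of `ℝ^d`: a scale `k : ℤ` and a position `n ∈ ℤ^d`. -/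
abbrev DIdx (d : ℕ) : Type := ℤ × (Fin d → ℤ)

/-- The dyadic cube `∏_j [2^k n_j, 2^k (n_j + 1))` of `ℝ^d`. -/
def dcube {d : ℕ} (i : DIdx d) : Set (Fin d → ℝ) :=
  {x | ∀ j, x j ∈ Set.Ico ((2 : ℝ) ^ i.1 * (i.2 j : ℝ)) ((2 : ℝ) ^ i.1 * ((i.2 j : ℝ) + 1))}

/-- The dyadic parent of a dyadic cube: the minimal dyadic cube strictly containing it. -/
def dparent {d : ℕ} (i : DIdx d) : DIdx d :=
  (i.1 + 1, fun j => Int.fdiv (i.2 j) 2)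

/-- The measure `ω dx` on `ℝ^d` associated with a weight `ω`. -/
def wMeasure {d : ℕ} (ω : (Fin d → ℝ) → ℝ≥0∞) : Measure (Fin d → ℝ) :=
  volume.withDensity ω

/-- The average of a nonnegative function `f` over the dyadic cube indexed by `i`,
with respect to the measure `μ`. -/
def cavg {d : ℕ} (μ : Measure (Fin d → ℝ)) (i : DIdx d) (f : (Fin d → ℝ) → ℝ≥0∞) : ℝ≥0∞ :=
  (∫⁻ x in dcube i, f x ∂μ) / μ (dcube i)

/-- Lebesgue average of a nonnegative function over a dyadic cube. -/
def lavg {d : ℕ} (i : DIdx d) (f : (Fin d → ℝ) → ℝ≥0∞) : ℝ≥0∞ :=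
  cavg volume i f

/-- The `L^p` norm (real exponent `p`) of a nonnegative function with respect to `μ`. -/
def lpn {d : ℕ} (p : ℝ) (μ : Measure (Fin d → ℝ)) (f : (Fin d → ℝ) → ℝ≥0∞) : ℝ≥0∞ :=
  (∫⁻ x, f x ^ p ∂μ) ^ (1 / p)

/-- The positive dyadic operator `T_τ f = ∑_Q τ_Q (E_Q f) 1_Q`. -/
def Tdy {d : ℕ} (τ : DIdx d → ℝ≥0∞) (f : (Fin d → ℝ) → ℝ≥0∞) (x : Fin d → ℝ) : ℝ≥0∞ :=
  ∑' i : DIdx d, (dcube i).indicator (fun _ => τ i * lavg i f) x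

/-- The local part `T^in_{τ,R} f = ∑_{Q ⊆ R} τ_Q (E_Q f) 1_Q`. -/
def TdyIn {d : ℕ} (τ : DIdx d → ℝ≥0∞) (R : DIdx d) (f : (Fin d → ℝ) → ℝ≥0∞)
    (x : Fin d → ℝ) : ℝ≥0∞ :=
  ∑' i : {i : DIdx d // dcube i ⊆ dcube R},
    (dcube i.1).indicator (fun _ => τ i.1 * lavg i.1 f) x

/-- The global part `T^out_{τ,R} f = ∑_{Q ⊇ R} τ_Q (E_Q f) 1_Q`. -/
def TdyOut {d : ℕ} (τ : DIdx d → ℝ≥0∞) (R : DIdx d) (f : (Fin d → ℝ) → ℝ≥0∞)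
    (x : Fin d → ℝ) : ℝ≥0∞ :=
  ∑' i : {i : DIdx d // dcube R ⊆ dcube i},
    (dcube i.1).indicator (fun _ => τ i.1 * lavg i.1 f) x

/-- The local testing constant `⟦σ,ω⟧^Loc_{τ,p,q}
= sup_{R : ω(R)>0} ω(R)^{-1/q'} ‖T^in_{τ,R}(1_R ω)‖_{L^{p'}(σ)}`. -/
def locTest {d : ℕ} (p q : ℝ) (τ : DIdx d → ℝ≥0∞) (σ ω : (Fin d → ℝ) → ℝ≥0∞) : ℝ≥0∞ :=
  ⨆ (R : DIdx d) (_ : wMeasure ω (dcube R) ≠ 0),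
    wMeasure ω (dcube R) ^ (-(1 / (q / (q - 1)))) *
      lpn (p / (p - 1)) (wMeasure σ) (TdyIn τ R ((dcube R).indicator ω))

/-- The global testing constant `⟦σ,ω⟧^Glo_{τ,p,q}
= sup_{R : ω(R)>0} ω(R)^{-1/q'} ‖T^out_{τ,R}(1_R ω)‖_{L^{p'}(σ)}`. -/
def gloTest {d : ℕ} (p q : ℝ) (τ : DIdx d → ℝ≥0∞) (σ ω : (Fin d → ℝ) → ℝ≥0∞) : ℝ≥0∞ :=
  ⨆ (R : DIdx d) (_ : wMeasure ω (dcube R) ≠ 0),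
    wMeasure ω (dcube R) ^ (-(1 / (q / (q - 1)))) *
      lpn (p / (p - 1)) (wMeasure σ) (TdyOut τ R ((dcube R).indicator ω))

/-- The least weak-type `L^p(σ) → L^{q,∞}(ω)` constant of `f ↦ T_τ(fσ)`. -/
def weakConst {d : ℕ} (p q : ℝ) (τ : DIdx d → ℝ≥0∞) (σ ω : (Fin d → ℝ) → ℝ≥0∞) : ℝ≥0∞ :=
  sInf {N : ℝ≥0∞ | ∀ f : (Fin d → ℝ) → ℝ≥0∞, Measurable f → lpn p (wMeasure σ) f ≠ ⊤ →
    ∀ lam : ℝ≥0∞, 0 < lam →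
      wMeasure ω {x | lam < Tdy τ (fun y => f y * σ y) x} ≤
        (N * lpn p (wMeasure σ) f / lam) ^ q}

section Abstract

variable {X ι : Type*}

/-- The sum of the coefficients `c i`, `i ∈ S`, over the sets `D i` containing `A`. -/
def outerSum (D : ι → Set X) (S : Finset ι) (c : ι → ℝ≥0∞) (A : Set X) : ℝ≥0∞ :=
  open Classical in ∑ i ∈ S with A ⊆ D i, c i

/-- The simple function `∑ i ∈ S, c i 1_{D i}`. -/
def finiteSum (D : ι → Set X) (S : Finset ι) (c : ι → ℝ≥0∞) (x : X) : ℝ≥0∞ :=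
  ∑ i ∈ S, (D i).indicator (fun _ => c i) x

/-- Any two sets of the family that intersect are comparable. -/
def IsNested (D : ι → Set X) : Prop :=
  ∀ i j x, x ∈ D i → x ∈ D j → D i ⊆ D j ∨ D j ⊆ D i

/-- Among finitely many sets of a nested family through a common point there is a smallest one,
so the sum of their coefficients is at most an outer sum. -/
lemma exists_sum_le_outerSum {D : ι → Set X} (hD : IsNested D) {S U : Finset ι} (hUS : U ⊆ S)
    (hU : U.Nonempty) {x : X} (hx : ∀ i ∈ U, x ∈ D i) (c : ι → ℝ≥0∞) :
    ∃ m ∈ U, ∑ i ∈ U, c i ≤ outerSum D S c (D m) := by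
  classical
  obtain ⟨m, hm, hmin⟩ := U.exists_minimalFor D hU
  refine ⟨m, hm, ?_⟩
  unfold outerSum
  refine Finset.sum_le_sum_of_subset fun j hj => ?_
  simp only [Finset.mem_filter]
  refine ⟨hUS hj, ?_⟩
  rcases hD m j x (hx m hm) (hx j hj) with h | h
  · exact h
  · exact hmin hj h

lemma finiteSum_eq_sum_filter (D : ι → Set X) (S : Finset ι) (c : ι → ℝ≥0∞) (x : X)
    [DecidablePred fun i => x ∈ D i] :
    finiteSum D S c x = ∑ i ∈ S with x ∈ D i, c i := by
  simp only [finiteSum, Set.indicator_apply, Finset.sum_filter]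

lemma exists_lt_outerSum {D : ι → Set X} (hD : IsNested D) {S : Finset ι} {c : ι → ℝ≥0∞}
    {x : X} {t : ℝ≥0∞} (h : t < finiteSum D S c x) :
    ∃ m ∈ S, x ∈ D m ∧ t < outerSum D S c (D m) := by
  classical
  rw [finiteSum_eq_sum_filter] at h
  have hne : (S.filter fun i => x ∈ D i).Nonempty := by
    by_contra h0
    rw [Finset.not_nonempty_iff_eq_empty] at h0
    simp [h0] at h
  obtain ⟨m, hm, hle⟩ := exists_sum_le_outerSum hD (Finset.filter_subset _ S) hne
    (fun i hi => (Finset.mem_filter.1 hi).2) c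
  exact ⟨m, (Finset.mem_filter.1 hm).1, (Finset.mem_filter.1 hm).2, h.trans_le hle⟩

variable [MeasurableSpace X]

/-- The coefficients `a i ∫_{D i} f dμ`. -/
def coeff (D : ι → Set X) (a : ι → ℝ≥0∞) (μ : Measure X) (f : X → ℝ≥0∞) (i : ι) : ℝ≥0∞ :=
  a i * ∫⁻ x in D i, f x ∂μ

/-- Inside a maximal set `P` on which the outer sum exceeds `t`, the operator exceeds `2 t` only
where the operator applied to `f 1_P` exceeds `t`. -/
lemma lt_finiteSum_indicator {D : ι → Set X} (hD : IsNested D)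
    (hDm : ∀ i, MeasurableSet (D i)) (a : ι → ℝ≥0∞) (μ : Measure X) (f : X → ℝ≥0∞)
    {S : Finset ι} {P : Set X} {k : ι} (hk : P = D k) {t : ℝ≥0∞}
    (hmax : ∀ j ∈ S, P ⊂ D j → outerSum D S (coeff D a μ f) (D j) ≤ t)
    {x : X} (hx : x ∈ P) (hlt : t + t < finiteSum D S (coeff D a μ f) x) :
    t < finiteSum D S (coeff D a μ (P.indicator f)) x := by
  classical
  by_contra! hle
  refine hlt.not_ge ?_
  have hsplit := Finset.sum_filter_add_sum_filter_not (S.filter fun i => x ∈ D i)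
    (fun i => P ⊂ D i) (coeff D a μ f)
  rw [finiteSum_eq_sum_filter, ← hsplit]
  refine add_le_add ?_ ?_
  · set U := (S.filter fun i => x ∈ D i).filter fun i => P ⊂ D i with hU
    rcases U.eq_empty_or_nonempty with h0 | hne
    · simp [h0]
    · have hmem : ∀ i ∈ U, i ∈ S ∧ x ∈ D i ∧ P ⊂ D i := fun i hi => by
        simpa [hU, and_assoc] using hi
      obtain ⟨m, hm, hms⟩ := exists_sum_le_outerSum hD (fun i hi => (hmem i hi).1) hne
        (fun i hi => (hmem i hi).2.1) (coeff D a μ f)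
      exact hms.trans (hmax m (hmem m hm).1 (hmem m hm).2.2)
  · refine le_trans ?_ hle
    rw [finiteSum_eq_sum_filter]
    refine le_trans (Finset.sum_le_sum fun i hi => ?_)
      (Finset.sum_le_sum_of_subset (Finset.filter_subset _ _))
    simp only [Finset.mem_filter] at hi
    obtain ⟨⟨-, hxi⟩, hni⟩ := hi
    have hsub : D i ⊆ P := by
      rcases hD i k x hxi (hk ▸ hx) with h | h
      · exact hk ▸ h
      · by_contra hc
        exact hni ⟨hk ▸ h, hc⟩
    refine mul_le_mul_right (le_of_eq (setLIntegral_congr_fun (hDm i) fun y hy => ?_)) _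
    simp [Set.indicator_of_mem (hsub hy)]

variable {D : ι → Set X} {a : ι → ℝ≥0∞} {μ ν : Measure X} {S : Finset ι} {p q r : ℝ} {B : ℝ≥0∞}

/-- The weak-type estimate with a constant depending on the number of sets. -/
lemma weak_type_card (hD : IsNested D) (hq : 0 < q) {f : X → ℝ≥0∞} {E : ℝ≥0∞}
    (hH : ∀ i, outerSum D S (coeff D a μ f) (D i) ^ q * ν (D i) ≤ E)
    (t : ℝ≥0∞) :
    t ^ q * ν {x | t < finiteSum D S (coeff D a μ f) x} ≤ S.card * E := by
  classical
  set V := S.filter fun i => t < outerSum D S (coeff D a μ f) (D i)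
  have hsub : {x | t < finiteSum D S (coeff D a μ f) x} ⊆ ⋃ i ∈ V, D i := by
    intro x hx
    obtain ⟨m, hm, hxm, hlt⟩ := exists_lt_outerSum hD hx
    simp only [Set.mem_iUnion]
    exact ⟨m, Finset.mem_filter.2 ⟨hm, hlt⟩, hxm⟩
  calc t ^ q * ν {x | t < finiteSum D S (coeff D a μ f) x}
      ≤ t ^ q * ∑ i ∈ V, ν (D i) := by
        gcongr
        exact (measure_mono hsub).trans (measure_biUnion_finset_le _ _)
    _ = ∑ i ∈ V, t ^ q * ν (D i) := Finset.mul_sum _ _ _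
    _ ≤ ∑ i ∈ V, E := by
        refine Finset.sum_le_sum fun i hi => le_trans ?_ (hH i)
        have := (Finset.mem_filter.1 hi).2.le
        gcongr
    _ ≤ S.card * E := by
        rw [Finset.sum_const, nsmul_eq_mul]
        gcongr
        exact Finset.filter_subset _ _

/-- Self-improvement of the weak-type constant: each maximal set either carries a fixed proportion
of the mass of `f`, or is handled by the weak-type estimate for the localized function. -/
lemma weak_type_improve (hD : IsNested D) (hDm : ∀ i, MeasurableSet (D i)) (hp : 0 < p)
    (hq : 0 < q) (hr : 1 < r)
    (hH : ∀ f : X → ℝ≥0∞, Measurable f → ∀ i,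
      outerSum D S (coeff D a μ f) (D i) ^ q * ν (D i) ≤ B * (∫⁻ x, f x ^ p ∂μ) ^ r)
    {δ K : ℝ≥0∞} (hδ : δ ≠ 0) (hδ' : δ ≠ ⊤)
    (hK : ∀ f : X → ℝ≥0∞, Measurable f → ∀ t : ℝ≥0∞,
      t ^ q * ν {x | t < finiteSum D S (coeff D a μ f) x} ≤ K * (B * (∫⁻ x, f x ^ p ∂μ) ^ r))
    {f : X → ℝ≥0∞} (hf : Measurable f) (t : ℝ≥0∞) :
    t ^ q * ν {x | t < finiteSum D S (coeff D a μ f) x} ≤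
      (2 ^ q * (δ⁻¹ + K * δ ^ (r - 1))) * (B * (∫⁻ x, f x ^ p ∂μ) ^ r) := by
  classical
  set e := ∫⁻ x, f x ^ p ∂μ with he
  set s := t / 2 with hs
  have hss : s + s = t := ENNReal.add_halves t
  have hts : t ^ q = 2 ^ q * s ^ q := by
    rw [← ENNReal.mul_rpow_of_nonneg _ _ hq.le, two_mul, hss]
  set W := (S.filter fun i => s < outerSum D S (coeff D a μ f) (D i)).image D with hW
  set M := W.filter fun A => Maximal (· ∈ W) A with hM
  have hMW : ∀ P ∈ M, Maximal (· ∈ W) P := fun P hP => (Finset.mem_filter.1 hP).2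
  have hMD : ∀ P ∈ M, ∃ k, D k = P ∧ s < outerSum D S (coeff D a μ f) P := by
    intro P hP
    obtain ⟨k, hk, hkP⟩ := Finset.mem_image.1 (hMW P hP).1
    exact ⟨k, hkP, hkP ▸ (Finset.mem_filter.1 hk).2⟩
  have hMm : ∀ P ∈ M, MeasurableSet P := by
    intro P hP
    obtain ⟨k, rfl, -⟩ := hMD P hP
    exact hDm k
  have hdisj : (M : Set (Set X)).PairwiseDisjoint id := by
    intro P hP Q hQ hPQ
    refine Set.disjoint_left.2 fun x hxP hxQ => hPQ ?_
    obtain ⟨k, hk, -⟩ := hMD P hP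
    obtain ⟨l, hl, -⟩ := hMD Q hQ
    have hnest := hD k l x (by rw [hk]; exact hxP) (by rw [hl]; exact hxQ)
    rw [hk, hl] at hnest
    rcases hnest with h | h
    · exact (hMW P hP).eq_of_le (hMW Q hQ).1 h
    · exact ((hMW Q hQ).eq_of_le (hMW P hP).1 h).symm
  have hst : s ≤ t := ENNReal.half_le_self
  have hcover : {x | t < finiteSum D S (coeff D a μ f) x} ⊆
      ⋃ P ∈ M, P ∩ {x | t < finiteSum D S (coeff D a μ f) x} := by
    intro x hx
    obtain ⟨m, hm, hxm, hlt⟩ := exists_lt_outerSum hD hx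
    have hmW : D m ∈ W :=
      Finset.mem_image_of_mem D (Finset.mem_filter.2 ⟨hm, hst.trans_lt hlt⟩)
    obtain ⟨P, hmP, hP⟩ := W.exists_le_maximal hmW
    simp only [Set.mem_iUnion]
    exact ⟨P, Finset.mem_filter.2 ⟨hP.1, hP⟩, hmP hxm, hx⟩
  have hpow : ∀ y : ℝ≥0∞, y ^ r = y ^ (r - 1) * y := fun y => by
    conv_lhs => rw [show r = (r - 1) + 1 by ring]
    rw [ENNReal.rpow_add_of_nonneg _ _ (by linarith) zero_le_one, ENNReal.rpow_one]
  have hind : ∀ P ∈ M, ∫⁻ x, P.indicator f x ^ p ∂μ = ∫⁻ x in P, f x ^ p ∂μ := by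
    intro P hP
    rw [← lintegral_indicator (hMm P hP)]
    refine lintegral_congr fun x => ?_
    by_cases hx : x ∈ P <;> simp [hx, hp]
  have hlocal : ∀ P ∈ M, s ^ q * ν (P ∩ {x | t < finiteSum D S (coeff D a μ f) x}) ≤
      (δ⁻¹ + K * δ ^ (r - 1)) * (B * (e ^ (r - 1) * ∫⁻ x in P, f x ^ p ∂μ)) := by
    intro P hP
    obtain ⟨k, hk, hsk⟩ := hMD P hP
    set eP := ∫⁻ x in P, f x ^ p ∂μ with heP
    rw [add_mul]
    by_cases hlight : eP ≤ δ * e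
    · refine le_trans ?_ le_add_self
      have hsub : P ∩ {x | t < finiteSum D S (coeff D a μ f) x} ⊆
          {x | s < finiteSum D S (coeff D a μ (P.indicator f)) x} := by
        rintro x ⟨hxP, hx⟩
        refine lt_finiteSum_indicator hD hDm a μ f hk.symm (fun j hj hPj => ?_) hxP
          (hss.symm ▸ hx)
        by_contra! hj'
        exact (hMW P hP).not_prop_of_gt hPj
          (Finset.mem_image_of_mem D (Finset.mem_filter.2 ⟨hj, hj'⟩))
      calc s ^ q * ν (P ∩ {x | t < finiteSum D S (coeff D a μ f) x})
          ≤ s ^ q * ν {x | s < finiteSum D S (coeff D a μ (P.indicator f)) x} := by gcongr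
        _ ≤ K * (B * eP ^ r) := by
          rw [heP, ← hind P hP]
          exact hK _ (hf.indicator (hMm P hP)) s
        _ ≤ K * (B * ((δ * e) ^ (r - 1) * eP)) := by
          rw [hpow eP]
          have : 0 ≤ r - 1 := by linarith
          gcongr
        _ = K * δ ^ (r - 1) * (B * (e ^ (r - 1) * eP)) := by
          rw [ENNReal.mul_rpow_of_nonneg _ _ (by linarith)]
          ring
    · refine le_trans ?_ le_self_add
      have hheavy : e ≤ δ⁻¹ * eP := by
        calc e = δ⁻¹ * (δ * e) := by
              rw [← mul_assoc, ENNReal.inv_mul_cancel hδ hδ', one_mul]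
          _ ≤ δ⁻¹ * eP := by
              have := (not_le.1 hlight).le
              gcongr
      calc s ^ q * ν (P ∩ {x | t < finiteSum D S (coeff D a μ f) x})
          ≤ outerSum D S (coeff D a μ f) P ^ q * ν P := by
            gcongr
            exact Set.inter_subset_left
        _ ≤ B * e ^ r := by
            rw [← hk]
            exact hH f hf k
        _ ≤ B * (e ^ (r - 1) * (δ⁻¹ * eP)) := by
            rw [hpow e]
            gcongr
        _ = δ⁻¹ * (B * (e ^ (r - 1) * eP)) := by ring
  have hmass : ∑ P ∈ M, ∫⁻ x in P, f x ^ p ∂μ ≤ e := by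
    exact (lintegral_biUnion_finset hdisj hMm _).symm.trans_le (setLIntegral_le_lintegral _ _)
  calc t ^ q * ν {x | t < finiteSum D S (coeff D a μ f) x}
      ≤ 2 ^ q * s ^ q * ∑ P ∈ M, ν (P ∩ {x | t < finiteSum D S (coeff D a μ f) x}) := by
        rw [hts]
        gcongr
        exact (measure_mono hcover).trans (measure_biUnion_finset_le _ _)
    _ = 2 ^ q * ∑ P ∈ M, s ^ q * ν (P ∩ {x | t < finiteSum D S (coeff D a μ f) x}) := by
        rw [Finset.mul_sum, Finset.mul_sum]
        exact Finset.sum_congr rfl fun _ _ => by ring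
    _ ≤ 2 ^ q * ∑ P ∈ M,
          (δ⁻¹ + K * δ ^ (r - 1)) * (B * (e ^ (r - 1) * ∫⁻ x in P, f x ^ p ∂μ)) := by
        exact mul_le_mul_right (Finset.sum_le_sum hlocal) _
    _ = 2 ^ q * ((δ⁻¹ + K * δ ^ (r - 1)) *
          (B * (e ^ (r - 1) * ∑ P ∈ M, ∫⁻ x in P, f x ^ p ∂μ))) := by
        simp only [Finset.mul_sum]
    _ ≤ 2 ^ q * ((δ⁻¹ + K * δ ^ (r - 1)) * (B * (e ^ (r - 1) * e))) := by gcongr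
    _ = _ := by
        rw [hpow e]
        ring

/-- Weak-type estimate for finitely many sets, with a constant independent of their number. -/
lemma weak_type_uniform (hD : IsNested D) (hDm : ∀ i, MeasurableSet (D i)) (hp : 0 < p)
    (hq : 0 < q) (hr : 1 < r)
    (hH : ∀ f : X → ℝ≥0∞, Measurable f → ∀ i,
      outerSum D S (coeff D a μ f) (D i) ^ q * ν (D i) ≤ B * (∫⁻ x, f x ^ p ∂μ) ^ r)
    {δ : ℝ≥0∞} (hδ : δ ≠ 0) (hδ' : δ ≠ ⊤) (hδr : 2 ^ q * δ ^ (r - 1) = 2⁻¹)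
    {f : X → ℝ≥0∞} (hf : Measurable f) (t : ℝ≥0∞) :
    t ^ q * ν {x | t < finiteSum D S (coeff D a μ f) x} ≤
      (2 * (2 ^ q * δ⁻¹) + 1) * (B * (∫⁻ x, f x ^ p ∂μ) ^ r) := by
  have key : ∀ n : ℕ, ∀ f : X → ℝ≥0∞, Measurable f → ∀ t : ℝ≥0∞,
      t ^ q * ν {x | t < finiteSum D S (coeff D a μ f) x} ≤
        (2 * (2 ^ q * δ⁻¹) + S.card * 2⁻¹ ^ n) * (B * (∫⁻ x, f x ^ p ∂μ) ^ r) := by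
    intro n
    induction n with
    | zero =>
      intro f hf t
      refine (weak_type_card hD hq (hH f hf) t).trans ?_
      gcongr
      simp
    | succ n ih =>
      intro f hf t
      refine (weak_type_improve hD hDm hp hq hr hH hδ hδ' ih hf t).trans (le_of_eq ?_)
      congr 1
      set c := 2 ^ q * δ⁻¹
      calc 2 ^ q * (δ⁻¹ + (2 * c + S.card * 2⁻¹ ^ n) * δ ^ (r - 1))
          = c + (2 * c + S.card * 2⁻¹ ^ n) * (2 ^ q * δ ^ (r - 1)) := by ring
        _ = c + (2⁻¹ * 2) * c + S.card * 2⁻¹ ^ (n + 1) := by rw [hδr]; ring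
        _ = 2 * c + S.card * 2⁻¹ ^ (n + 1) := by
          rw [ENNReal.inv_mul_cancel two_ne_zero ENNReal.ofNat_ne_top]
          ring
  refine (key S.card f hf t).trans ?_
  gcongr
  calc (S.card : ℝ≥0∞) * 2⁻¹ ^ S.card ≤ 2 ^ S.card * 2⁻¹ ^ S.card := by
        gcongr
        exact_mod_cast S.card.lt_two_pow_self.le
    _ = 1 := by
        rw [← mul_pow, ENNReal.mul_inv_cancel two_ne_zero ENNReal.ofNat_ne_top, one_pow]

end Abstract

section Dyadic

variable {d : ℕ}

lemma measurableSet_dcube (i : DIdx d) : MeasurableSet (dcube i) := by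
  have : dcube i = Set.univ.pi fun j =>
      Set.Ico ((2 : ℝ) ^ i.1 * (i.2 j : ℝ)) ((2 : ℝ) ^ i.1 * ((i.2 j : ℝ) + 1)) := by
    ext x
    simp [dcube]
  rw [this]
  exact MeasurableSet.univ_pi fun j => measurableSet_Ico

lemma dcube_subset_of_le {i j : DIdx d} (hij : i.1 ≤ j.1) {x : Fin d → ℝ} (hi : x ∈ dcube i)
    (hj : x ∈ dcube j) : dcube i ⊆ dcube j := by
  intro y hy c
  obtain ⟨t, ht⟩ := Int.le.dest hij
  have h2 : (2 : ℝ) ^ j.1 = 2 ^ i.1 * ((2 ^ t : ℤ) : ℝ) := by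
    rw [← ht, zpow_add₀ two_ne_zero]
    simp
  have hpos : (0 : ℝ) < 2 ^ i.1 := by positivity
  obtain ⟨hi1, hi2⟩ := hi c
  obtain ⟨hj1, hj2⟩ := hj c
  obtain ⟨hy1, hy2⟩ := hy c
  rw [h2, mul_assoc] at hj1 hj2
  have ha : (2 ^ t : ℤ) * j.2 c < i.2 c + 1 := by
    exact_mod_cast lt_of_mul_lt_mul_left (hj1.trans_lt hi2) hpos.le
  have hb : i.2 c < (2 ^ t : ℤ) * (j.2 c + 1) := by
    exact_mod_cast lt_of_mul_lt_mul_left (hi1.trans_lt hj2) hpos.le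
  have ha' : ((2 ^ t : ℤ) : ℝ) * j.2 c ≤ i.2 c := by exact_mod_cast Int.lt_add_one_iff.1 ha
  have hb' : (i.2 c : ℝ) + 1 ≤ ((2 ^ t : ℤ) : ℝ) * (j.2 c + 1) := by
    exact_mod_cast Int.add_one_le_iff.2 hb
  rw [Set.mem_Ico, h2, mul_assoc, mul_assoc]
  exact ⟨(mul_le_mul_of_nonneg_left ha' hpos.le).trans hy1,
    hy2.trans_le (mul_le_mul_of_nonneg_left hb' hpos.le)⟩

lemma isNested_dcube : IsNested (dcube (d := d)) := by
  intro i j x hi hj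
  rcases le_total i.1 j.1 with h | h
  · exact Or.inl (dcube_subset_of_le h hi hj)
  · exact Or.inr (dcube_subset_of_le h hj hi)

variable {p q : ℝ} {τ : DIdx d → ℝ≥0∞} {σ ω : (Fin d → ℝ) → ℝ≥0∞}

lemma mul_lavg_eq_coeff (hσ : Measurable σ) {f : (Fin d → ℝ) → ℝ≥0∞} (hf : Measurable f)
    (i : DIdx d) :
    τ i * lavg i (fun y => f y * σ y) =
      coeff dcube (fun i => τ i * (volume (dcube i))⁻¹) (wMeasure σ) f i := by
  have : ∫⁻ x in dcube i, f x ∂(wMeasure σ) = ∫⁻ x in dcube i, f x * σ x := by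
    rw [wMeasure, setLIntegral_withDensity_eq_setLIntegral_mul _ hσ hf (measurableSet_dcube i)]
    exact lintegral_congr fun x => mul_comm _ _
  rw [coeff, this, lavg, cavg, div_eq_mul_inv]
  ring

lemma TdyOut_indicator_weight (R : DIdx d) (x : Fin d → ℝ) :
    TdyOut τ R ((dcube R).indicator ω) x = wMeasure ω (dcube R) *
      ∑' i : {i : DIdx d // dcube R ⊆ dcube i},
        (dcube i.1).indicator (fun _ => τ i * (volume (dcube i.1))⁻¹) x := by
  rw [TdyOut, ← ENNReal.tsum_mul_left]
  refine tsum_congr fun i => ?_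
  by_cases hx : x ∈ dcube i.1
  · rw [Set.indicator_of_mem hx, Set.indicator_of_mem hx, lavg, cavg,
      setLIntegral_indicator (measurableSet_dcube R), Set.inter_eq_left.2 i.2, wMeasure,
      withDensity_apply _ (measurableSet_dcube R), div_eq_mul_inv]
    ring
  · rw [Set.indicator_of_notMem hx, Set.indicator_of_notMem hx, mul_zero]

/-- Global testing, dualized: it controls the outer sums at each cube. -/
lemma outerSum_rpow_mul_le (hp : 1 < p) (hq : 1 < q)
    (hω : ∀ i : DIdx d, wMeasure ω (dcube i) ≠ ⊤) (S : Finset (DIdx d))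
    {f : (Fin d → ℝ) → ℝ≥0∞} (hf : Measurable f) (R : DIdx d) :
    outerSum dcube S (coeff dcube (fun i => τ i * (volume (dcube i))⁻¹) (wMeasure σ) f)
        (dcube R) ^ q * wMeasure ω (dcube R) ≤
      gloTest p q τ σ ω ^ q * (∫⁻ x, f x ^ p ∂(wMeasure σ)) ^ (q / p) := by
  classical
  set w := wMeasure ω (dcube R) with hw
  have hq0 : 0 < q := by linarith
  rcases eq_or_ne w 0 with hw0 | hw0
  · simp [hw0]
  set a : DIdx d → ℝ≥0∞ := fun i => τ i * (volume (dcube i))⁻¹ with ha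
  set h : (Fin d → ℝ) → ℝ≥0∞ := fun x =>
    ∑' i : {i : DIdx d // dcube R ⊆ dcube i}, (dcube i.1).indicator (fun _ => a i) x with hh
  set p' := p / (p - 1) with hp'
  have hconj : p.HolderConjugate p' := Real.HolderConjugate.conjExponent hp
  have hhm : Measurable h := Measurable.tsum fun i =>
    measurable_const.indicator (measurableSet_dcube i.1)
  have htest : w ^ (1 / q) * lpn p' (wMeasure σ) h ≤ gloTest p q τ σ ω := by
    have hle : w ^ (-(1 / (q / (q - 1)))) *
        lpn p' (wMeasure σ) (TdyOut τ R ((dcube R).indicator ω)) ≤ gloTest p q τ σ ω :=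
      le_iSup₂ (f := fun (R : DIdx d) (_ : wMeasure ω (dcube R) ≠ 0) =>
        wMeasure ω (dcube R) ^ (-(1 / (q / (q - 1)))) *
          lpn (p / (p - 1)) (wMeasure σ) (TdyOut τ R ((dcube R).indicator ω))) R hw0
    refine le_trans (le_of_eq ?_) hle
    have hT : TdyOut τ R ((dcube R).indicator ω) = fun x => w * h x :=
      funext fun x => TdyOut_indicator_weight R x
    have hlpn : lpn p' (wMeasure σ) (fun x => w * h x) = w * lpn p' (wMeasure σ) h := by
      simp only [lpn, ENNReal.mul_rpow_of_nonneg _ _ hconj.symm.nonneg]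
      rw [lintegral_const_mul _ (hhm.pow_const _),
        ENNReal.mul_rpow_of_nonneg _ _ hconj.symm.one_div_nonneg, ← ENNReal.rpow_mul,
        mul_one_div_cancel hconj.symm.ne_zero, ENNReal.rpow_one]
    rw [hT, hlpn, ← mul_assoc]
    congr 1
    nth_rewrite 3 [← ENNReal.rpow_one w]
    rw [← ENNReal.rpow_add _ _ hw0 (hω R)]
    congr 1
    field_simp
    ring
  have hdual : outerSum dcube S (coeff dcube a (wMeasure σ) f) (dcube R) ≤
      lpn p (wMeasure σ) f * lpn p' (wMeasure σ) h := by
    refine le_trans ?_ (ENNReal.lintegral_mul_le_Lp_mul_Lq _ hconj hf.aemeasurable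
      hhm.aemeasurable)
    calc outerSum dcube S (coeff dcube a (wMeasure σ) f) (dcube R)
        = ∫⁻ x, ∑ i ∈ S with dcube R ⊆ dcube i,
            f x * (dcube i).indicator (fun _ => a i) x ∂(wMeasure σ) := by
          refine Eq.trans ?_ (lintegral_finsetSum _ fun i _ =>
            hf.mul (measurable_const.indicator (measurableSet_dcube i))).symm
          rw [outerSum]
          refine Finset.sum_congr rfl fun i _ => ?_
          rw [coeff, ← lintegral_const_mul _ hf, ← lintegral_indicator (measurableSet_dcube i)]
          refine lintegral_congr fun x => ?_
          by_cases hx : x ∈ dcube i <;> simp [hx, mul_comm]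
      _ ≤ ∫⁻ x, (f * h) x ∂(wMeasure σ) := by
          refine lintegral_mono fun x => ?_
          simp only [Pi.mul_apply]
          rw [← Finset.mul_sum]
          gcongr
          rw [Finset.sum_filter, hh]
          refine le_trans (ENNReal.sum_le_tsum S) (le_of_eq ?_)
          refine Eq.trans ?_ (tsum_subtype {i : DIdx d | dcube R ⊆ dcube i}
            (fun i => (dcube i).indicator (fun _ => a i) x)).symm
          refine tsum_congr fun i => ?_
          simp [Set.indicator_apply]
  calc outerSum dcube S (coeff dcube a (wMeasure σ) f) (dcube R) ^ q * w
      ≤ (lpn p (wMeasure σ) f * lpn p' (wMeasure σ) h) ^ q * (w ^ (1 / q)) ^ q := by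
        rw [← ENNReal.rpow_mul, one_div_mul_cancel hq0.ne', ENNReal.rpow_one]
        gcongr
    _ = (w ^ (1 / q) * lpn p' (wMeasure σ) h) ^ q * lpn p (wMeasure σ) f ^ q := by
        simp only [ENNReal.mul_rpow_of_nonneg _ _ hq0.le]
        ring
    _ ≤ gloTest p q τ σ ω ^ q * (∫⁻ x, f x ^ p ∂(wMeasure σ)) ^ (q / p) := by
        have : lpn p (wMeasure σ) f ^ q = (∫⁻ x, f x ^ p ∂(wMeasure σ)) ^ (q / p) := by
          rw [lpn, ← ENNReal.rpow_mul, one_div_mul_eq_div]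
        rw [this]
        gcongr

end Dyadic

/-- **Sufficiency of global testing for the weak-type bound, `p < q`.** -/
theorem stmt11 (d : ℕ) (p q : ℝ) (hp : 1 < p) (hpq : p < q) :
    ∃ C : ℝ≥0∞, 0 < C ∧ C < ⊤ ∧
      ∀ (τ : DIdx d → ℝ≥0∞) (σ ω : (Fin d → ℝ) → ℝ≥0∞),
        Measurable σ → Measurable ω →
        (∀ i : DIdx d, wMeasure σ (dcube i) ≠ ⊤) →
        (∀ i : DIdx d, wMeasure ω (dcube i) ≠ ⊤) →
        gloTest p q τ σ ω ≠ ⊤ →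
        ∀ f : (Fin d → ℝ) → ℝ≥0∞, Measurable f → lpn p (wMeasure σ) f ≠ ⊤ →
          ∀ lam : ℝ≥0∞, 0 < lam →
            lam ^ q * wMeasure ω {x | lam < Tdy τ (fun y => f y * σ y) x} ≤
              C * gloTest p q τ σ ω ^ q * lpn p (wMeasure σ) f ^ q := by
  have hp0 : 0 < p := by linarith
  have hq0 : 0 < q := by linarith
  have hr : 1 < q / p := (one_lt_div hp0).2 hpq
  have hr0 : q / p - 1 ≠ 0 := by linarith
  set b : ℝ≥0∞ := (2 ^ q)⁻¹ * 2⁻¹ with hb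
  have h2q0 : (2 : ℝ≥0∞) ^ q ≠ 0 := by simp
  have h2q : (2 : ℝ≥0∞) ^ q ≠ ⊤ := ENNReal.rpow_ne_top_of_nonneg hq0.le ENNReal.ofNat_ne_top
  have hb0 : b ≠ 0 := by simp [hb, h2q]
  have hbt : b ≠ ⊤ := ENNReal.mul_ne_top (by simp) (by simp)
  set δ : ℝ≥0∞ := b ^ (q / p - 1)⁻¹ with hδdef
  have hδ : δ ≠ 0 := (ENNReal.rpow_pos (pos_iff_ne_zero.2 hb0) hbt).ne'
  have hδ' : δ ≠ ⊤ := ENNReal.rpow_ne_top_of_nonneg (inv_nonneg.2 (by linarith)) hbt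
  have hδr : 2 ^ q * δ ^ (q / p - 1) = 2⁻¹ := by
    rw [hδdef, ← ENNReal.rpow_mul, inv_mul_cancel₀ hr0, ENNReal.rpow_one, hb, ← mul_assoc,
      ENNReal.mul_inv_cancel h2q0 h2q, one_mul]
  refine ⟨2 * (2 ^ q * δ⁻¹) + 1, by positivity, ?_, ?_⟩
  · refine lt_top_iff_ne_top.2 (ENNReal.add_ne_top.2 ⟨?_, ENNReal.one_ne_top⟩)
    exact ENNReal.mul_ne_top ENNReal.ofNat_ne_top
      (ENNReal.mul_ne_top h2q (ENNReal.inv_ne_top.2 hδ))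
  intro τ σ ω hσ _ _ hω _ f hf _ t _
  set c := coeff dcube (fun i => τ i * (volume (dcube i))⁻¹) (wMeasure σ) f
  have hset : {x | t < Tdy τ (fun y => f y * σ y) x} =
      ⋃ S : Finset (DIdx d), {x | t < finiteSum dcube S c x} := by
    ext x
    simp only [Set.mem_ofPred_eq, Set.mem_iUnion, Tdy, mul_lavg_eq_coeff hσ hf]
    rw [ENNReal.tsum_eq_iSup_sum, lt_iSup_iff]
    rfl
  have hdir : Directed (· ⊆ ·) fun S : Finset (DIdx d) => {x | t < finiteSum dcube S c x} := by
    refine Monotone.directed_le (f := fun S : Finset (DIdx d) =>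
      {x | t < finiteSum dcube S c x}) fun S U hSU x hx => ?_
    exact lt_of_lt_of_le (b := finiteSum dcube S c x) hx (Finset.sum_le_sum_of_subset hSU)
  rw [hset, hdir.measure_iUnion, ENNReal.mul_iSup]
  refine iSup_le fun S => ?_
  refine (weak_type_uniform isNested_dcube measurableSet_dcube hp0 hq0 hr
    (fun f hf R => outerSum_rpow_mul_le hp (hp.trans hpq) hω S hf R) hδ hδ' hδr hf t).trans
    (le_of_eq ?_)
  rw [lpn, ← ENNReal.rpow_mul, one_div_mul_eq_div, mul_assoc]
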